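/- arXiv:2508.01645 — 2 statements merged into one kernel-verified Lean document; each statement's English description precedes it below -/
import Mathlib

section
/- If M is a nontrivial compact MT-algebra (⊥ ≠ ⊤), then the set of nonzero closed elements of M contains a minimal element: there is a closed c ≠ ⊥ such that every closed d with ⊥ ≠ d ≤ c satisfies d = c. -/
/-- An element `u` is open w.r.t. the interior operator `box` if `box u = u`. -/
def MTOpen {M : Type*} [CompleteBooleanAlgebra M] (box : M → M) (u : M) : Prop :=
  box u = u

/-- The closure operator `◇a = ¬□¬a`. -/
def MTdia {M : Type*} [CompleteBooleanAlgebra M] (box : M → M) (a : M) : M :=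
  (box aᶜ)ᶜ

/-- An element `c` is closed if `◇c = c`. -/
def MTClosed {M : Type*} [CompleteBooleanAlgebra M] (box : M → M) (c : M) : Prop :=
  MTdia box c = c

/-- `box` is an interior operator making the complete Boolean algebra `M` an MT-algebra. -/
def IsMT {M : Type*} [CompleteBooleanAlgebra M] (box : M → M) : Prop :=
  box ⊤ = ⊤ ∧ (∀ a b : M, box (a ⊓ b) = box a ⊓ box b) ∧
    (∀ a : M, box a ≤ a) ∧ (∀ a : M, box a ≤ box (box a))

/-- A subset `S` of a complete lattice is join-dense if every element is a join
of a subset of `S`. -/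
def JoinDense {M : Type*} [CompleteLattice M] (S : Set M) : Prop :=
  ∀ a : M, ∃ T ⊆ S, a = sSup T

/-- `k` is compact: every open cover of `k` has a finite subcover. -/
def MTCompactElem {M : Type*} [CompleteBooleanAlgebra M] (box : M → M) (k : M) : Prop :=
  ∀ U : Set M, (∀ u ∈ U, MTOpen box u) → k ≤ sSup U →
    ∃ V ⊆ U, V.Finite ∧ k ≤ sSup V

/-- `a ◁ b` iff there is a compact `k` with `a ≤ k ≤ b`. -/
def MTWayInside {M : Type*} [CompleteBooleanAlgebra M] (box : M → M) (a b : M) : Prop :=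
  ∃ k : M, MTCompactElem box k ∧ a ≤ k ∧ k ≤ b

/-- `M` is N-locally compact if every nonzero `a` meets the interior of some
compact element. -/
def MTNLocallyCompact {M : Type*} [CompleteBooleanAlgebra M] (box : M → M) : Prop :=
  ∀ a : M, a ≠ ⊥ → ∃ k : M, MTCompactElem box k ∧ a ⊓ box k ≠ ⊥

/-- `M` is locally compact if every open is the join of the opens way inside it. -/
def MTLocallyCompact {M : Type*} [CompleteBooleanAlgebra M] (box : M → M) : Prop :=
  ∀ u : M, MTOpen box u → u = sSup {v : M | MTOpen box v ∧ MTWayInside box v u}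

theorem IsMT.monotone {M : Type*} [CompleteBooleanAlgebra M] {box : M → M}
    (hMT : IsMT box) : Monotone box := fun a b hab => by
  have h := hMT.2.1 a b
  rw [inf_eq_left.mpr hab] at h
  exact inf_eq_left.mp h.symm

theorem IsMT.open_sSup {M : Type*} [CompleteBooleanAlgebra M] {box : M → M}
    (hMT : IsMT box) {U : Set M} (hU : ∀ u ∈ U, MTOpen box u) : MTOpen box (sSup U) :=
  le_antisymm (hMT.2.2.1 _) <| sSup_le fun u hu =>
    (hU u hu).symm.le.trans (hMT.monotone (le_sSup hu))

theorem MTClosed_iff_open_compl {M : Type*} [CompleteBooleanAlgebra M] {box : M → M} {c : M} :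
    MTClosed box c ↔ MTOpen box cᶜ := by
  unfold MTClosed MTOpen MTdia
  exact compl_eq_comm.trans eq_comm

theorem IsChain.sSup_mem_of_finite {M : Type*} [CompleteLattice M] {V : Set M}
    (hV : IsChain (· ≤ ·) V) (hfin : V.Finite) (hne : V.Nonempty) : sSup V ∈ V := by
  obtain ⟨m, hm⟩ := hfin.exists_maximal hne
  have hgreatest : IsGreatest V m :=
    ⟨hm.prop, fun v hv => (hV.total hv hm.prop).elim id (hm.le_of_ge hv)⟩
  exact hgreatest.isLUB.sSup_eq.symm ▸ hm.prop

/-- In a nontrivial compact MT-algebra some open element is maximal among the proper ones. -/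
theorem IsMT.exists_maximal_open {M : Type*} [CompleteBooleanAlgebra M] {box : M → M}
    (hMT : IsMT box) (hnt : (⊥ : M) ≠ ⊤) (hcomp : MTCompactElem box ⊤) :
    ∃ m : M, Maximal (· ∈ {u : M | MTOpen box u ∧ u ≠ ⊤}) m := by
  refine zorn_le₀ _ fun C hC hchain =>
    ⟨sSup C, ⟨hMT.open_sSup fun u hu => (hC hu).1, fun htop => ?_⟩, fun _ => le_sSup⟩
  obtain ⟨V, hVC, hfin, hV⟩ := hcomp C (fun u hu => (hC hu).1) htop.ge
  rcases V.eq_empty_or_nonempty with rfl | hne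
  · exact hnt (by simpa [eq_comm] using hV)
  · exact (hC (hVC ((hchain.mono hVC).sSup_mem_of_finite hfin hne))).2 (top_le_iff.mp hV)

/-- Every nontrivial compact MT-algebra contains a minimal nonzero closed element. -/
theorem compact_has_minimal_closed {M : Type*} [CompleteBooleanAlgebra M] (box : M → M)
    (hMT : IsMT box) (hnt : (⊥ : M) ≠ ⊤) (hcomp : MTCompactElem box ⊤) :
    ∃ c : M, MTClosed box c ∧ c ≠ ⊥ ∧
      ∀ d : M, MTClosed box d → d ≠ ⊥ → d ≤ c → d = c := by
  obtain ⟨m, ⟨hopen, htop⟩, hmax⟩ := hMT.exists_maximal_open hnt hcomp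
  refine ⟨mᶜ, MTClosed_iff_open_compl.mpr (by rwa [compl_compl]),
    fun h => htop (compl_eq_bot.mp h), fun d hd hd0 hdm => le_antisymm hdm ?_⟩
  exact compl_le_of_compl_le
    (hmax ⟨MTClosed_iff_open_compl.mp hd, fun h => hd0 (compl_eq_top.mp h)⟩
      (le_compl_of_le_compl hdm))
end

section
/- Every locally compact T½-algebra is spatial: if M is an MT-algebra in which the T½-elements are join-dense and every open u satisfies u = ⨆{v open : v ◁ u}, then M is atomic, i.e., every nonzero element of M has an atom below it. -/
/-- `s` is saturated if it is a meet of a set of open elements. -/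
def MTSaturated {M : Type*} [CompleteBooleanAlgebra M] (box : M → M) (s : M) : Prop :=
  ∃ U : Set M, (∀ u ∈ U, MTOpen box u) ∧ s = sInf U

/-- `a` is a `T₀`-element if it is the meet of a saturated and a closed element. -/
def MTT0Elem {M : Type*} [CompleteBooleanAlgebra M] (box : M → M) (a : M) : Prop :=
  ∃ s c : M, MTSaturated box s ∧ MTClosed box c ∧ a = s ⊓ c

/-- `a` is a `T½`-element if it is the meet of an open and a closed element. -/
def MTThalfElem {M : Type*} [CompleteBooleanAlgebra M] (box : M → M) (a : M) : Prop :=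
  ∃ u c : M, MTOpen box u ∧ MTClosed box c ∧ a = u ⊓ c

section MTAlgebra

variable {M : Type*} [CompleteBooleanAlgebra M] {box : M → M}

/-- An element is closed iff its complement is open. -/
theorem mtClosed_iff_mtOpen_compl {c : M} : MTClosed box c ↔ MTOpen box cᶜ := by
  unfold MTClosed MTdia MTOpen
  exact compl_eq_comm.trans eq_comm

theorem IsMT.monotone_box (hMT : IsMT box) : Monotone box := fun a b hab => by
  have h := hMT.2.1 a b
  rw [inf_eq_left.2 hab] at h
  exact inf_eq_left.1 h.symm

/-- A join of open elements is open. -/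
theorem IsMT.mtOpen_sSup (hMT : IsMT box) {U : Set M} (hU : ∀ u ∈ U, MTOpen box u) :
    MTOpen box (sSup U) :=
  le_antisymm (hMT.2.2.1 _) <| sSup_le fun u hu =>
    (hU u hu).ge.trans (hMT.monotone_box (le_sSup hu))

theorem IsMT.mtOpen_sup (hMT : IsMT box) {u v : M} (hu : MTOpen box u) (hv : MTOpen box v) :
    MTOpen box (u ⊔ v) := by
  rw [← sSup_pair]
  exact hMT.mtOpen_sSup (by rintro w (rfl | rfl) <;> assumption)

/-- Every nonzero element lies above a nonzero member of a join-dense set. -/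
theorem JoinDense.exists_ne_bot_le {S : Set M} (hS : JoinDense S) {a : M} (ha : a ≠ ⊥) :
    ∃ b ∈ S, b ≠ ⊥ ∧ b ≤ a := by
  obtain ⟨T, hTS, rfl⟩ := hS a
  by_contra! h
  exact ha (sSup_eq_bot.2 fun b hb => by_contra fun hne => h b (hTS hb) hne (le_sSup hb))

/-- An open element not above a compact element `k` extends to one maximal with that property. -/
theorem MTCompactElem.exists_maximal_mtOpen (hMT : IsMT box) {k : M} (hk : MTCompactElem box k)
    {w : M} (hw : MTOpen box w) (hkw : ¬ k ≤ w) :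
    ∃ m, w ≤ m ∧ Maximal (· ∈ {v : M | MTOpen box v ∧ ¬ k ≤ v}) m := by
  refine zorn_le_nonempty₀ _ (fun C hC hchain y hy => ?_) w ⟨hw, hkw⟩
  refine ⟨sSup C, ⟨hMT.mtOpen_sSup fun u hu => (hC hu).1, fun hle => ?_⟩, fun z => le_sSup⟩
  obtain ⟨V, hVC, hVfin, hkV⟩ := hk C (fun u hu => (hC hu).1) hle
  rcases V.eq_empty_or_nonempty with rfl | hVne
  · exact (hC hy).2 (hkV.trans (by simp))
  · obtain ⟨m, hm⟩ := hVfin.exists_maximal hVne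
    refine (hC (hVC hm.prop)).2 (hkV.trans (sSup_le fun v hv => ?_))
    rcases hchain.total (hVC hv) (hVC hm.prop) with h | h
    · exact h
    · exact hm.le_of_ge hv h

/-- In a `T½`-algebra, a nonzero element that no open element splits is an atom. -/
theorem isAtom_of_forall_mtOpen (hThalf : JoinDense {a : M | MTThalfElem box a}) {x : M}
    (hx : x ≠ ⊥) (h : ∀ v, MTOpen box v → x ≤ v ∨ Disjoint x v) : IsAtom x := by
  refine isAtom_iff_le_of_ge.2 ⟨hx, fun y hy hyx => ?_⟩
  obtain ⟨_, ⟨u, c, hu, hc, rfl⟩, hne, hle⟩ := hThalf.exists_ne_bot_le hy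
  refine le_trans (le_inf ?_ ?_) hle
  · refine (h u hu).resolve_right fun hd => hne ?_
    exact le_bot_iff.1 (hd (hle.trans hyx) inf_le_left)
  · rcases h cᶜ (mtClosed_iff_mtOpen_compl.1 hc) with hd | hd
    · refine absurd (le_bot_iff.1 ?_) hne
      exact disjoint_compl_right inf_le_right ((hle.trans hyx).trans hd)
    · exact disjoint_compl_right_iff.1 hd

end MTAlgebra

/-- Every locally compact `T½`-algebra is spatial (i.e., atomic). -/
theorem locally_compact_thalf_spatial {M : Type*} [CompleteBooleanAlgebra M] (box : M → M)
    (hMT : IsMT box) (hThalf : JoinDense {a : M | MTThalfElem box a})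
    (hLC : MTLocallyCompact box) :
    ∀ a : M, a ≠ ⊥ → ∃ x : M, IsAtom x ∧ x ≤ a := by
  intro a ha
  obtain ⟨_, ⟨u, c, hu, hc, rfl⟩, hne, hle⟩ := hThalf.exists_ne_bot_le ha
  have hc' := mtClosed_iff_mtOpen_compl.1 hc
  obtain ⟨k, hk, hku, hkc⟩ : ∃ k, MTCompactElem box k ∧ k ≤ u ∧ ¬ k ≤ cᶜ := by
    by_contra! h
    have huc : u ≤ cᶜ := by
      rw [hLC u hu]
      exact sSup_le fun v ⟨_, k, hk, hvk, hku⟩ => hvk.trans (h k hk hku)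
    exact hne (le_compl_iff_disjoint_right.1 huc).eq_bot
  obtain ⟨m, hcm, hm⟩ := hk.exists_maximal_mtOpen hMT hc' hkc
  refine ⟨k ⊓ mᶜ, isAtom_of_forall_mtOpen hThalf ?_ fun v hv => ?_,
    le_trans (inf_le_inf hku (compl_le_of_compl_le hcm)) hle⟩
  · rw [← sdiff_eq, Ne, sdiff_eq_bot_iff]
    exact hm.prop.2
  · by_cases hkv : k ≤ m ⊔ v
    · left
      rwa [← sdiff_eq, sdiff_le_iff]
    · right
      have hvm : v ≤ m :=
        le_sup_right.trans (hm.le_of_ge ⟨hMT.mtOpen_sup hm.prop.1 hv, hkv⟩ le_sup_left)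
      exact (disjoint_compl_left.mono_right hvm).mono_left inf_le_right
end
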